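/- arXiv:0903.5056 — 2 statements merged into one kernel-verified Lean document; each statement's English description precedes it below -/
import Mathlib

section
/- For every pair of nonnegative integers k, l there exist real polynomials p₁, p₂, p₃ ∈ ℝ[t] with 4·deg pᵢ ≤ k + l + 1 for i = 1,2,3, such that for all t ∈ (0, 1/64): I_{k,l}(t) = p₁(t)·J₁(t) + p₂(t)·J₂(t) + p₃(t)·J₃(t). -/
open MeasureTheory Set Filter

/-- The region bounded by the real oval of `{x^2 y (1-x-y) = t}` in the first quadrant. -/
def Δset (t : ℝ) : Set (ℝ × ℝ) :=
  {z : ℝ × ℝ | 0 < z.1 ∧ 0 < z.2 ∧ t ≤ z.1 ^ 2 * z.2 * (1 - z.1 - z.2)}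

/-- The Abelian integral `I_{i,j}(t) = ∬_{Δ(t)} x^i y^j dx dy` (integer powers). -/
noncomputable def Iab (i j : ℤ) (t : ℝ) : ℝ :=
  ∫ z in Δset t, z.1 ^ i * z.2 ^ j

noncomputable def J1 (t : ℝ) : ℝ := Iab 0 0 t
noncomputable def J2 (t : ℝ) : ℝ := Iab 2 0 t
noncomputable def J3 (t : ℝ) : ℝ := Iab 3 0 t

/-- The width of the vertical slice of `Δset t` over `x`, wherever that slice is nonempty. -/
noncomputable def sliceWidth (t x : ℝ) : ℝ := √((1 - x) ^ 2 - 4 * t / x ^ 2)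

/-- The left end of the projection of `Δset t` to the `x`-axis; the right end is `1 - leftEnd t`. -/
noncomputable def leftEnd (t : ℝ) : ℝ := (1 - √(1 - 8 * √t)) / 2

/-- The difference of the `n`-th powers of the two ends of the slice of `Δset t` over `x`. -/
noncomputable def powDiff (t : ℝ) (n : ℕ) (x : ℝ) : ℝ :=
  ((1 - x + sliceWidth t x) / 2) ^ n - ((1 - x - sliceWidth t x) / 2) ^ n

/-- The one-dimensional form of `(l + 1) * Iab k l t`. -/
noncomputable def sliceMoment (k : ℤ) (l : ℕ) (t : ℝ) : ℝ :=
  ∫ x in leftEnd t..(1 - leftEnd t), x ^ k * powDiff t (l + 1) x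

section Slices

variable {t : ℝ}

lemma leftEnd_pos (ht : t ∈ Ioo (0 : ℝ) (1 / 64)) : 0 < leftEnd t := by
  have h0 : 0 < √t := Real.sqrt_pos.2 ht.1
  have : √(1 - 8 * √t) < 1 := by
    rw [Real.sqrt_lt' one_pos]; linarith
  unfold leftEnd; linarith

lemma leftEnd_le_half (t : ℝ) : leftEnd t ≤ 1 / 2 := by
  have := Real.sqrt_nonneg (1 - 8 * √t)
  unfold leftEnd; linarith

lemma leftEnd_mul (ht : t ∈ Ioo (0 : ℝ) (1 / 64)) :
    leftEnd t * (1 - leftEnd t) = 2 * √t := by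
  have h1 : √t < 1 / 8 := by
    rw [Real.sqrt_lt' (by norm_num)]; linarith [ht.2]
  have h2 : √(1 - 8 * √t) ^ 2 = 1 - 8 * √t := Real.sq_sqrt (by linarith)
  unfold leftEnd; linear_combination (-1 / 4) * h2

lemma mem_Icc_leftEnd_iff (ht : t ∈ Ioo (0 : ℝ) (1 / 64)) {x : ℝ} (hx : 0 < x) (hx1 : x < 1) :
    x ∈ Icc (leftEnd t) (1 - leftEnd t) ↔ 4 * t ≤ x ^ 2 * (1 - x) ^ 2 := by
  have hm := leftEnd_mul ht
  have hh := leftEnd_le_half t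
  have hr := Real.sqrt_nonneg t
  have hr2 : √t ^ 2 = t := Real.sq_sqrt ht.1.le
  have hprod : (x - leftEnd t) * (1 - leftEnd t - x) = x * (1 - x) - 2 * √t := by
    linear_combination -hm
  have hxs : 0 < x * (1 - x) := mul_pos hx (by linarith)
  constructor
  · rintro ⟨h1, h2⟩
    have := mul_nonneg (sub_nonneg.2 h1) (sub_nonneg.2 h2)
    have h3 : 2 * √t ≤ x * (1 - x) := by linarith
    have := pow_le_pow_left₀ (by positivity) h3 2
    nlinarith
  · intro h
    have h3 : 2 * √t ≤ x * (1 - x) := by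
      refine le_of_sq_le_sq ?_ hxs.le
      nlinarith
    constructor
    · by_contra hc
      nlinarith
    · by_contra hc
      nlinarith

lemma pos_of_mem_Icc_leftEnd (ht : t ∈ Ioo (0 : ℝ) (1 / 64)) {x : ℝ}
    (hx : x ∈ Icc (leftEnd t) (1 - leftEnd t)) : 0 < x ∧ x < 1 := by
  have := leftEnd_pos ht
  exact ⟨by linarith [hx.1], by linarith [hx.2]⟩

lemma sliceWidth_sq (ht : t ∈ Ioo (0 : ℝ) (1 / 64)) {x : ℝ}
    (hx : x ∈ Icc (leftEnd t) (1 - leftEnd t)) :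
    sliceWidth t x ^ 2 = (1 - x) ^ 2 - 4 * t / x ^ 2 := by
  obtain ⟨h0, h1⟩ := pos_of_mem_Icc_leftEnd ht hx
  refine Real.sq_sqrt (sub_nonneg.2 ?_)
  rw [div_le_iff₀ (by positivity)]
  linarith [(mem_Icc_leftEnd_iff ht h0 h1).1 hx]

lemma mul_sliceWidth {x : ℝ} (hx : 0 < x) :
    x * sliceWidth t x = √(x ^ 2 * (1 - x) ^ 2 - 4 * t) := by
  rw [sliceWidth, ← Real.sqrt_sq hx.le, ← Real.sqrt_mul (by positivity), Real.sqrt_sq hx.le]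
  congr 1
  field_simp

lemma continuousOn_sliceWidth (ht : t ∈ Ioo (0 : ℝ) (1 / 64)) :
    ContinuousOn (sliceWidth t) (Icc (leftEnd t) (1 - leftEnd t)) := by
  unfold sliceWidth
  refine ContinuousOn.sqrt (ContinuousOn.sub (by fun_prop) (ContinuousOn.div (by fun_prop)
    (by fun_prop) fun x hx => ?_))
  have := (pos_of_mem_Icc_leftEnd ht hx).1
  positivity

lemma continuousOn_zpow_Icc_leftEnd (ht : t ∈ Ioo (0 : ℝ) (1 / 64)) (k : ℤ) :
    ContinuousOn (fun x : ℝ => x ^ k) (Icc (leftEnd t) (1 - leftEnd t)) :=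
  continuousOn_id.zpow₀ k fun _ hx => Or.inl (pos_of_mem_Icc_leftEnd ht hx).1.ne'

lemma continuousOn_powDiff (ht : t ∈ Ioo (0 : ℝ) (1 / 64)) (n : ℕ) :
    ContinuousOn (powDiff t n) (Icc (leftEnd t) (1 - leftEnd t)) := by
  have := continuousOn_sliceWidth ht
  unfold powDiff
  fun_prop

lemma intervalIntegrable_zpow_mul_powDiff (ht : t ∈ Ioo (0 : ℝ) (1 / 64)) (k : ℤ) (n : ℕ) :
    IntervalIntegrable (fun x => x ^ k * powDiff t n x) volume (leftEnd t) (1 - leftEnd t) := by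
  apply ContinuousOn.intervalIntegrable_of_Icc (by linarith [leftEnd_le_half t])
  exact (continuousOn_zpow_Icc_leftEnd ht k).mul (continuousOn_powDiff ht n)

lemma powDiff_one (x : ℝ) : powDiff t 1 x = sliceWidth t x := by
  unfold powDiff; ring

lemma powDiff_two (x : ℝ) : powDiff t 2 x = (1 - x) * sliceWidth t x := by
  unfold powDiff; ring

lemma powDiff_add_two (ht : t ∈ Ioo (0 : ℝ) (1 / 64)) (n : ℕ) {x : ℝ}
    (hx : x ∈ Icc (leftEnd t) (1 - leftEnd t)) :
    powDiff t (n + 2) x = (1 - x) * powDiff t (n + 1) x - t / x ^ 2 * powDiff t n x := by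
  have h : t / x ^ 2 = ((1 - x) ^ 2 - sliceWidth t x ^ 2) / 4 := by
    rw [sliceWidth_sq ht hx]; ring
  rw [h]; unfold powDiff; ring

end Slices

section Fubini

variable {t : ℝ}

lemma mem_Icc_leftEnd_of_mem_Δset (ht : t ∈ Ioo (0 : ℝ) (1 / 64)) {x y : ℝ}
    (h : (x, y) ∈ Δset t) : 0 < 1 - x - y ∧ x ∈ Icc (leftEnd t) (1 - leftEnd t) := by
  obtain ⟨hx, hy, hH⟩ := h
  simp only at hx hy hH
  have hz : 0 < 1 - x - y := by
    by_contra hc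
    have : 0 ≤ x ^ 2 * y := by positivity
    nlinarith [ht.1]
  refine ⟨hz, (mem_Icc_leftEnd_iff ht hx (by linarith)).2 ?_⟩
  nlinarith [mul_nonneg (sq_nonneg x) (sq_nonneg (1 - x - 2 * y))]

lemma mem_Δset_iff (ht : t ∈ Ioo (0 : ℝ) (1 / 64)) {x : ℝ}
    (hx : x ∈ Icc (leftEnd t) (1 - leftEnd t)) (y : ℝ) :
    (x, y) ∈ Δset t ↔
      y ∈ Icc ((1 - x - sliceWidth t x) / 2) ((1 - x + sliceWidth t x) / 2) := by
  obtain ⟨h0, h1⟩ := pos_of_mem_Icc_leftEnd ht hx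
  have hw := sliceWidth_sq ht hx
  have hw0 : 0 ≤ sliceWidth t x := Real.sqrt_nonneg _
  set w := sliceWidth t x
  have hx2 : 0 < x ^ 2 := by positivity
  have htx : 4 * t = x ^ 2 * ((1 - x) ^ 2 - w ^ 2) := by
    rw [hw]; field_simp; ring
  have hws : w < 1 - x := by
    refine lt_of_pow_lt_pow_left₀ 2 (by linarith) ?_
    rw [hw]
    have : 0 < 4 * t / x ^ 2 := div_pos (by linarith [ht.1]) hx2
    linarith
  have key : t ≤ x ^ 2 * y * (1 - x - y) ↔ (2 * y - (1 - x)) ^ 2 ≤ w ^ 2 := by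
    rw [← mul_le_mul_iff_right₀ hx2 (b := (2 * y - (1 - x)) ^ 2)]
    constructor <;> intro h <;> linarith
  rw [Δset, mem_ofPred_eq, sq_le_sq, abs_of_nonneg hw0, abs_le] at *
  simp only [mem_Icc]
  constructor
  · rintro ⟨-, -, h⟩
    have := key.1 h
    constructor <;> linarith
  · rintro ⟨ha, hb⟩
    exact ⟨h0, by linarith, key.2 ⟨by linarith, by linarith⟩⟩

lemma measurableSet_Δset (t : ℝ) : MeasurableSet (Δset t) := by
  have hH : Measurable fun z : ℝ × ℝ => z.1 ^ 2 * z.2 * (1 - z.1 - z.2) := by fun_prop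
  exact (measurableSet_lt measurable_const measurable_fst).inter
    ((measurableSet_lt measurable_const measurable_snd).inter
      (measurableSet_le measurable_const hH))

lemma Iab_eq_sliceMoment (ht : t ∈ Ioo (0 : ℝ) (1 / 64)) (k l : ℕ) :
    Iab k l t = sliceMoment k l t / (l + 1) := by
  have hle : leftEnd t ≤ 1 - leftEnd t := by linarith [leftEnd_le_half t]
  have hint : IntegrableOn (fun z : ℝ × ℝ => z.1 ^ k * z.2 ^ l) (Δset t) := by
    refine IntegrableOn.mono_set (t := Icc (0, 0) (1, 1))
      (Continuous.continuousOn (by fun_prop)).integrableOn_Icc ?_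
    rintro ⟨x, y⟩ h
    have h1 := (mem_Icc_leftEnd_of_mem_Δset ht h).1
    obtain ⟨hx, hy, -⟩ := h
    simp only at hx hy
    exact ⟨⟨hx.le, hy.le⟩, ⟨by simp only; linarith, by simp only; linarith⟩⟩
  have hslice : ∀ x : ℝ,
      ∫ y, (Δset t).indicator (fun z : ℝ × ℝ => z.1 ^ k * z.2 ^ l) (x, y) =
        (Icc (leftEnd t) (1 - leftEnd t)).indicator
          (fun x => x ^ k * powDiff t (l + 1) x / (l + 1)) x := by
    intro x
    by_cases hx : x ∈ Icc (leftEnd t) (1 - leftEnd t)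
    · have hw0 : 0 ≤ sliceWidth t x := Real.sqrt_nonneg _
      have : (fun y => (Δset t).indicator (fun z : ℝ × ℝ => z.1 ^ k * z.2 ^ l) (x, y)) =
          (Icc ((1 - x - sliceWidth t x) / 2) ((1 - x + sliceWidth t x) / 2)).indicator
            (fun y => x ^ k * y ^ l) := by
        ext y
        simp only [indicator, mem_Δset_iff ht hx]
      rw [this, integral_indicator measurableSet_Icc, integral_Icc_eq_integral_Ioc,
        ← intervalIntegral.integral_of_le (by linarith), intervalIntegral.integral_const_mul,
        integral_pow, indicator_of_mem hx, powDiff, mul_div_assoc]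
    · rw [indicator_of_notMem hx]
      refine integral_eq_zero_of_ae (Eventually.of_forall fun y => ?_)
      exact indicator_of_notMem (fun h => hx (mem_Icc_leftEnd_of_mem_Δset ht h).2) _
  simp only [Iab, zpow_natCast]
  rw [← integral_indicator (measurableSet_Δset t), Measure.volume_eq_prod,
    integral_prod _ ((integrable_indicator_iff (measurableSet_Δset t)).2 hint)]
  simp only [hslice]
  rw [integral_indicator measurableSet_Icc, integral_Icc_eq_integral_Ioc,
    ← intervalIntegral.integral_of_le hle, intervalIntegral.integral_div, sliceMoment]
  simp only [zpow_natCast]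

end Fubini

section Relations

variable {t : ℝ}

lemma sliceMoment_one (ht : t ∈ Ioo (0 : ℝ) (1 / 64)) (k : ℤ) :
    sliceMoment k 1 t = sliceMoment k 0 t - sliceMoment (k + 1) 0 t := by
  have hle : leftEnd t ≤ 1 - leftEnd t := by linarith [leftEnd_le_half t]
  unfold sliceMoment
  rw [← intervalIntegral.integral_sub (intervalIntegrable_zpow_mul_powDiff ht _ _)
    (intervalIntegrable_zpow_mul_powDiff ht _ _)]
  refine intervalIntegral.integral_congr fun x hx => ?_
  rw [uIcc_of_le hle] at hx
  have h0 := (pos_of_mem_Icc_leftEnd ht hx).1.ne'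
  simp only [zero_add, Nat.reduceAdd, powDiff_one, powDiff_two, zpow_add_one₀ h0]
  ring

lemma sliceMoment_add_two (ht : t ∈ Ioo (0 : ℝ) (1 / 64)) (k : ℤ) (l : ℕ) :
    sliceMoment k (l + 2) t = sliceMoment k (l + 1) t - sliceMoment (k + 1) (l + 1) t
      - t * sliceMoment (k - 2) l t := by
  have hle : leftEnd t ≤ 1 - leftEnd t := by linarith [leftEnd_le_half t]
  have hi := fun k n => intervalIntegrable_zpow_mul_powDiff ht k n
  unfold sliceMoment
  rw [← intervalIntegral.integral_const_mul, ← intervalIntegral.integral_sub (hi _ _) (hi _ _),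
    ← intervalIntegral.integral_sub ((hi _ _).sub (hi _ _)) ((hi _ _).const_mul t)]
  refine intervalIntegral.integral_congr fun x hx => ?_
  rw [uIcc_of_le hle] at hx
  have h0 := (pos_of_mem_Icc_leftEnd ht hx).1.ne'
  simp only [zpow_add_one₀ h0, zpow_sub₀ h0, show l + 2 + 1 = l + 1 + 2 by ring,
    powDiff_add_two ht _ hx]
  norm_cast
  ring

lemma sliceMoment_one_zero (ht : t ∈ Ioo (0 : ℝ) (1 / 64)) :
    sliceMoment 1 0 t = 2 * sliceMoment 2 0 t := by
  have hle : leftEnd t ≤ 1 - leftEnd t := by linarith [leftEnd_le_half t]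
  have hi := fun k n => intervalIntegrable_zpow_mul_powDiff ht k n
  have hfun : sliceMoment 1 0 t - 2 * sliceMoment 2 0 t =
      ∫ x in leftEnd t..(1 - leftEnd t), (1 - 2 * x) * √(x ^ 2 * (1 - x) ^ 2 - 4 * t) := by
    unfold sliceMoment
    rw [← intervalIntegral.integral_const_mul,
      ← intervalIntegral.integral_sub (hi _ _) ((hi _ _).const_mul 2)]
    refine intervalIntegral.integral_congr fun x hx => ?_
    rw [uIcc_of_le hle] at hx
    simp only [zero_add, powDiff_one, ← mul_sliceWidth (pos_of_mem_Icc_leftEnd ht hx).1]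
    norm_cast
    ring
  have hsymm := intervalIntegral.integral_comp_sub_left (a := leftEnd t) (b := 1 - leftEnd t)
    (fun x => (1 - 2 * x) * √(x ^ 2 * (1 - x) ^ 2 - 4 * t)) 1
  have hneg : ∀ x : ℝ, (1 - 2 * (1 - x)) * √((1 - x) ^ 2 * (1 - (1 - x)) ^ 2 - 4 * t) =
      -((1 - 2 * x) * √(x ^ 2 * (1 - x) ^ 2 - 4 * t)) := by
    intro x
    rw [show (1 - x) ^ 2 * (1 - (1 - x)) ^ 2 = x ^ 2 * (1 - x) ^ 2 by ring]
    ring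
  rw [sub_sub_cancel] at hsymm
  simp only [hneg, intervalIntegral.integral_neg] at hsymm
  linarith

lemma sliceWidth_leftEnd (ht : t ∈ Ioo (0 : ℝ) (1 / 64)) :
    sliceWidth t (leftEnd t) = 0 ∧ sliceWidth t (1 - leftEnd t) = 0 := by
  have h0 := leftEnd_pos ht
  have hh := leftEnd_le_half t
  have hsq : leftEnd t ^ 2 * (1 - leftEnd t) ^ 2 = 4 * t := by
    rw [← mul_pow, leftEnd_mul ht, mul_pow, Real.sq_sqrt ht.1.le]; norm_num
  have h1 := mul_sliceWidth (t := t) h0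
  have h2 := mul_sliceWidth (t := t) (x := 1 - leftEnd t) (by linarith)
  rw [hsq, sub_self, Real.sqrt_zero] at h1
  rw [sub_sub_cancel, mul_comm (_ ^ 2), hsq, sub_self, Real.sqrt_zero] at h2
  exact ⟨(mul_eq_zero.1 h1).resolve_left h0.ne',
    (mul_eq_zero.1 h2).resolve_left (by linarith)⟩

lemma hasDerivAt_zpow_mul_sliceWidth_pow (m : ℤ) {x : ℝ} (hx : 0 < x)
    (hw : 0 < (1 - x) ^ 2 - 4 * t / x ^ 2) :
    HasDerivAt (fun x => x ^ (m + 3) * sliceWidth t x ^ 3)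
      ((m + 3) * (x ^ (m + 2) * sliceWidth t x) - (2 * m + 9) * (x ^ (m + 3) * sliceWidth t x)
        + (m + 6) * (x ^ (m + 4) * sliceWidth t x) - 4 * m * (t * (x ^ m * sliceWidth t x))) x := by
  have hx0 := hx.ne'
  have hrad : HasDerivAt (fun x : ℝ => (1 - x) ^ 2 - 4 * t / x ^ 2)
      (-2 * (1 - x) + 8 * t / x ^ 3) x := by
    refine ((((hasDerivAt_id x).const_sub 1).pow 2).sub
      ((hasDerivAt_const x (4 * t)).div (hasDerivAt_pow 2 x) (by positivity))).congr_deriv ?_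
    simp only [id]
    field_simp
    push_cast
    ring
  have hsqrt := (hrad.sqrt hw.ne').pow 3
  have hW : √((1 - x) ^ 2 - 4 * t / x ^ 2) ≠ 0 := (Real.sqrt_pos.2 hw).ne'
  have hW2 := Real.sq_sqrt hw.le
  refine ((hasDerivAt_zpow (m + 3) x (Or.inl hx0)).mul hsqrt).congr_deriv ?_
  simp only [sliceWidth, Pi.pow_apply]
  set W := √((1 - x) ^ 2 - 4 * t / x ^ 2)
  have e2 : x ^ (m + 3 - 1) = x ^ m * x ^ 2 := by
    rw [show m + 3 - 1 = m + (2 : ℕ) by push_cast; ring, zpow_add₀ hx0, zpow_natCast]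
  have e2' : x ^ (m + 2) = x ^ m * x ^ 2 := by
    rw [zpow_add₀ hx0]; norm_cast
  have e3 : x ^ (m + 3) = x ^ m * x ^ 3 := by
    rw [zpow_add₀ hx0]; norm_cast
  have e4 : x ^ (m + 4) = x ^ m * x ^ 4 := by
    rw [zpow_add₀ hx0]; norm_cast
  have hW3 : W ^ 3 = W * ((1 - x) ^ 2 - 4 * t / x ^ 2) := by rw [← hW2]; ring
  rw [e2, e2', e3, e4, hW3]
  push_cast
  field_simp
  ring

lemma sliceMoment_recurrence (ht : t ∈ Ioo (0 : ℝ) (1 / 64)) (m : ℤ) :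
    (m + 3) * sliceMoment (m + 2) 0 t - (2 * m + 9) * sliceMoment (m + 3) 0 t
      + (m + 6) * sliceMoment (m + 4) 0 t - 4 * m * (t * sliceMoment m 0 t) = 0 := by
  have hle : leftEnd t ≤ 1 - leftEnd t := by linarith [leftEnd_le_half t]
  have hi : ∀ k : ℤ, IntervalIntegrable (fun x => x ^ k * sliceWidth t x) volume
      (leftEnd t) (1 - leftEnd t) := fun k => by
    simpa only [powDiff_one] using intervalIntegrable_zpow_mul_powDiff ht k 1
  have hsum := ((((hi (m + 2)).const_mul (m + 3 : ℝ)).sub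
    ((hi (m + 3)).const_mul (2 * m + 9 : ℝ))).add ((hi (m + 4)).const_mul (m + 6 : ℝ))).sub
    (((hi m).const_mul t).const_mul (4 * m : ℝ))
  have hftc := intervalIntegral.integral_eq_sub_of_hasDerivAt_of_le hle
    ((continuousOn_zpow_Icc_leftEnd ht (m + 3)).mul ((continuousOn_sliceWidth ht).pow 3))
    (fun x hx => hasDerivAt_zpow_mul_sliceWidth_pow m
      (pos_of_mem_Icc_leftEnd ht (Ioo_subset_Icc_self hx)).1 ?_) hsum
  · simp only [Pi.mul_apply, Pi.pow_apply, (sliceWidth_leftEnd ht).1, (sliceWidth_leftEnd ht).2]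
      at hftc
    rw [intervalIntegral.integral_sub, intervalIntegral.integral_add,
      intervalIntegral.integral_sub] at hftc
    · simp only [intervalIntegral.integral_const_mul] at hftc
      simp only [sliceMoment, zero_add, powDiff_one]
      rw [hftc]; ring
    all_goals
      first
      | exact (hi _).const_mul _
      | exact ((hi _).const_mul _).const_mul _
      | exact ((hi _).const_mul _).sub ((hi _).const_mul _)
      | exact (((hi _).const_mul _).sub ((hi _).const_mul _)).add ((hi _).const_mul _)
  · obtain ⟨h0, h1⟩ := pos_of_mem_Icc_leftEnd ht (Ioo_subset_Icc_self hx)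
    have hprod := mul_pos (sub_pos.2 hx.1) (sub_pos.2 hx.2)
    have hlt : 2 * √t < x * (1 - x) := by
      rw [← leftEnd_mul ht]; linarith
    have := pow_lt_pow_left₀ hlt (by positivity) two_ne_zero
    rw [mul_pow, Real.sq_sqrt ht.1.le] at this
    rw [sub_pos, div_lt_iff₀ (by positivity)]
    linarith

end Relations

/-- `f` is a combination of `J1`, `J2`, `J3` on `(0, 1/64)` whose polynomial coefficients have
degree at most `(d + 1) / 4`. -/
def PetrovDecomposable (d : ℤ) (f : ℝ → ℝ) : Prop :=
  ∃ p₁ p₂ p₃ : Polynomial ℝ,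
    4 * (p₁.natDegree : ℤ) ≤ d + 1 ∧ 4 * (p₂.natDegree : ℤ) ≤ d + 1 ∧
      4 * (p₃.natDegree : ℤ) ≤ d + 1 ∧
    ∀ t ∈ Ioo (0 : ℝ) (1 / 64), f t = p₁.eval t * J1 t + p₂.eval t * J2 t + p₃.eval t * J3 t

namespace PetrovDecomposable

open Polynomial

variable {d e : ℤ} {f g : ℝ → ℝ}

lemma mono (h : PetrovDecomposable d f) (hde : d ≤ e) : PetrovDecomposable e f := by
  obtain ⟨p₁, p₂, p₃, h₁, h₂, h₃, h⟩ := h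
  exact ⟨p₁, p₂, p₃, by lia, by lia, by lia, h⟩

lemma congr (h : PetrovDecomposable d f) (hfg : ∀ t ∈ Ioo (0 : ℝ) (1 / 64), g t = f t) :
    PetrovDecomposable d g := by
  obtain ⟨p₁, p₂, p₃, h₁, h₂, h₃, h⟩ := h
  exact ⟨p₁, p₂, p₃, h₁, h₂, h₃, fun t ht => (hfg t ht).trans (h t ht)⟩

lemma add (hf : PetrovDecomposable d f) (hg : PetrovDecomposable d g) :
    PetrovDecomposable d (fun t => f t + g t) := by
  obtain ⟨p₁, p₂, p₃, h₁, h₂, h₃, h⟩ := hf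
  obtain ⟨q₁, q₂, q₃, k₁, k₂, k₃, k⟩ := hg
  have a₁ := natDegree_add_le p₁ q₁
  have a₂ := natDegree_add_le p₂ q₂
  have a₃ := natDegree_add_le p₃ q₃
  refine ⟨p₁ + q₁, p₂ + q₂, p₃ + q₃, by lia, by lia, by lia, fun t ht => ?_⟩
  simp only [h t ht, k t ht, eval_add]
  ring

lemma const_mul (c : ℝ) (hf : PetrovDecomposable d f) :
    PetrovDecomposable d (fun t => c * f t) := by
  obtain ⟨p₁, p₂, p₃, h₁, h₂, h₃, h⟩ := hf
  have a₁ := natDegree_C_mul_le c p₁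
  have a₂ := natDegree_C_mul_le c p₂
  have a₃ := natDegree_C_mul_le c p₃
  refine ⟨C c * p₁, C c * p₂, C c * p₃, by lia, by lia, by lia, fun t ht => ?_⟩
  simp only [h t ht, eval_mul, eval_C]
  ring

lemma self_mul (hf : PetrovDecomposable d f) :
    PetrovDecomposable (d + 4) (fun t => t * f t) := by
  obtain ⟨p₁, p₂, p₃, h₁, h₂, h₃, h⟩ := hf
  have a : ∀ p : ℝ[X], (X * p).natDegree ≤ 1 + p.natDegree := fun p =>
    natDegree_mul_le.trans (by gcongr; exact natDegree_X_le)
  have a₁ := a p₁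
  have a₂ := a p₂
  have a₃ := a p₃
  refine ⟨X * p₁, X * p₂, X * p₃, by lia, by lia, by lia, fun t ht => ?_⟩
  simp only [h t ht, eval_mul, eval_X]
  ring

lemma pow_mul (hf : PetrovDecomposable d f) (i : ℕ) :
    PetrovDecomposable (d + 4 * i) (fun t => t ^ i * f t) := by
  induction i with
  | zero => simpa using hf
  | succ i ih =>
    refine (ih.self_mul.mono (by push_cast; lia)).congr fun t _ => ?_
    ring

lemma sliceMoment_natCast_zero (m : ℕ) : PetrovDecomposable m (sliceMoment m 0) := by
  induction m using Nat.strong_induction_on with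
  | _ m ih =>
    match m with
    | 0 =>
      refine ⟨1, 0, 0, by simp, by simp, by simp, fun t ht => ?_⟩
      have := Iab_eq_sliceMoment ht 0 0
      simp only [J1, eval_one, eval_zero]
      simp at this ⊢
      linarith
    | 1 =>
      refine ⟨0, C 2, 0, by simp, by simp, by simp, fun t ht => ?_⟩
      have := Iab_eq_sliceMoment ht 2 0
      have h1 := sliceMoment_one_zero ht
      simp only [J2, eval_C, eval_zero]
      simp at this ⊢
      linarith
    | 2 =>
      refine ⟨0, 1, 0, by simp, by simp, by simp, fun t ht => ?_⟩
      have := Iab_eq_sliceMoment ht 2 0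
      simp only [J2, eval_one, eval_zero]
      simp at this ⊢
      linarith
    | 3 =>
      refine ⟨0, 0, 1, by simp, by simp, by simp, fun t ht => ?_⟩
      have := Iab_eq_sliceMoment ht 3 0
      simp only [J3, eval_one, eval_zero]
      simp at this ⊢
      linarith
    | m + 4 =>
      have h0 := ((ih m (by lia)).self_mul.mono (e := (m + 4 : ℕ)) (by lia)).const_mul
        (4 * m / (m + 6))
      have h2 := ((ih (m + 2) (by lia)).mono (e := (m + 4 : ℕ)) (by lia)).const_mul
        (-(m + 3) / (m + 6))
      have h3 := ((ih (m + 3) (by lia)).mono (e := (m + 4 : ℕ)) (by lia)).const_mul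
        ((2 * m + 9) / (m + 6))
      refine ((h0.add h2).add h3).congr fun t ht => ?_
      have := sliceMoment_recurrence ht m
      push_cast at this ⊢
      field_simp
      linarith

lemma pow_mul_sliceMoment_zero (i : ℕ) (k : ℤ) (hk : 0 ≤ k + 2 * i) :
    PetrovDecomposable (k + 4 * i) (fun t => t ^ i * sliceMoment k 0 t) := by
  induction i generalizing k with
  | zero =>
    lift k to ℕ using by simpa using hk
    exact (sliceMoment_natCast_zero k).pow_mul 0
  | succ i ih =>
    push_cast at hk ⊢
    rcases le_or_gt 0 k with h | h
    · lift k to ℕ using h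
      exact_mod_cast (sliceMoment_natCast_zero k).pow_mul (i + 1)
    · have hk0 : (k : ℝ) ≠ 0 := by exact_mod_cast h.ne
      have h2 := ((ih (k + 2) (by lia)).mono (e := k + 4 * (i + 1)) (by lia)).const_mul
        ((k + 3) / (4 * k))
      have h3 := ((ih (k + 3) (by lia)).mono (e := k + 4 * (i + 1)) (by lia)).const_mul
        (-(2 * k + 9) / (4 * k))
      have h4 := ((ih (k + 4) (by lia)).mono (e := k + 4 * (i + 1)) (by lia)).const_mul
        ((k + 6) / (4 * k))
      refine ((h2.add h3).add h4).congr fun t ht => ?_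
      have := sliceMoment_recurrence ht k
      field_simp
      linear_combination (-t ^ i) * this

lemma pow_mul_sliceMoment (l i : ℕ) (k : ℤ) (hk : 0 ≤ k + 2 * i) :
    PetrovDecomposable (k + l + 4 * i) (fun t => t ^ i * sliceMoment k l t) := by
  induction l using Nat.strong_induction_on generalizing i k with
  | _ l ih =>
    match l with
    | 0 => simpa using pow_mul_sliceMoment_zero i k hk
    | 1 =>
      have h0 := (pow_mul_sliceMoment_zero i k hk).mono (e := k + (1 : ℕ) + 4 * i) (by lia)
      have h1 := (pow_mul_sliceMoment_zero i (k + 1) (by lia)).mono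
        (e := k + (1 : ℕ) + 4 * i) (by lia)
      refine (h0.add (h1.const_mul (-1))).congr fun t ht => ?_
      rw [sliceMoment_one ht]
      ring
    | l + 2 =>
      have h0 := (ih (l + 1) (by lia) i k hk).mono (e := k + (l + 2 : ℕ) + 4 * i) (by lia)
      have h1 := (ih (l + 1) (by lia) i (k + 1) (by lia)).mono
        (e := k + (l + 2 : ℕ) + 4 * i) (by lia)
      have h2 := (ih l (by lia) (i + 1) (k - 2) (by lia)).mono
        (e := k + (l + 2 : ℕ) + 4 * i) (by lia)
      refine ((h0.add (h1.const_mul (-1))).add (h2.const_mul (-1))).congr fun t ht => ?_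
      rw [sliceMoment_add_two ht]
      ring

end PetrovDecomposable

/-- every `I_{k,l}` with `k, l ≥ 0` decomposes in the Petrov module
generated by `J₁, J₂, J₃` with polynomial coefficients of degree at most `(k+l+1)/4`. -/
theorem petrov_module_decomposition_monomial (k l : ℕ) :
    ∃ p₁ p₂ p₃ : Polynomial ℝ,
      4 * p₁.natDegree ≤ k + l + 1 ∧ 4 * p₂.natDegree ≤ k + l + 1 ∧
        4 * p₃.natDegree ≤ k + l + 1 ∧
      ∀ t ∈ Set.Ioo (0 : ℝ) (1 / 64),
        Iab (k : ℤ) (l : ℤ) t =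
          p₁.eval t * J1 t + p₂.eval t * J2 t + p₃.eval t * J3 t := by
  obtain ⟨p₁, p₂, p₃, h₁, h₂, h₃, h⟩ :=
    (PetrovDecomposable.pow_mul_sliceMoment l 0 k (by simp)).const_mul (1 / (l + 1))
  refine ⟨p₁, p₂, p₃, by lia, by lia, by lia, fun t ht => ?_⟩
  rw [← h t ht, Iab_eq_sliceMoment ht]
  ring
end

section
/- The functions J₁, J₂, J₃ are differentiable on (0, 1/64), and with D(t) = 64t² − t their derivatives satisfy for all t ∈ (0, 1/64): D(t)·J₁′(t) = (−1/2 + 32t)·J₁(t) + 9·J₂(t) − 10·J₃(t); D(t)·J₂′(t) = (3/2 + 48t)·J₂(t) − (5/2)·J₃(t); D(t)·J₃′(t) = (3/2 − 24t)·J₂(t) + (−5/2 + 80t)·J₃(t). -/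
open MeasureTheory Set Filter

/-- The integrand of `ovalIntegral`. With `x = 1/2 + √(1/4 - s) sin θ` and `q = x (1 - x)`, it is
`q ^ m * √(q ^ 2 - s ^ 2)` times `dx/dθ`, written in terms of `cos θ`. -/
noncomputable def ovalIntegrand (m : ℤ) (s θ : ℝ) : ℝ :=
  (1 / 4 - s) * Real.cos θ ^ 2 * (s + (1 / 4 - s) * Real.cos θ ^ 2) ^ m *
    √(2 * s + (1 / 4 - s) * Real.cos θ ^ 2)

/-- The partial derivative of `ovalIntegrand m s θ` in `s`. -/
noncomputable def ovalIntegrandDeriv (m : ℤ) (s θ : ℝ) : ℝ :=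
  (-(Real.cos θ ^ 2 * (s + (1 / 4 - s) * Real.cos θ ^ 2) ^ m) +
      (1 / 4 - s) * Real.cos θ ^ 2 *
        (m * (s + (1 / 4 - s) * Real.cos θ ^ 2) ^ (m - 1) * (1 - Real.cos θ ^ 2))) *
    √(2 * s + (1 / 4 - s) * Real.cos θ ^ 2) +
  (1 / 4 - s) * Real.cos θ ^ 2 * (s + (1 / 4 - s) * Real.cos θ ^ 2) ^ m *
    ((2 - Real.cos θ ^ 2) / (2 * √(2 * s + (1 / 4 - s) * Real.cos θ ^ 2)))

/-- The integral of `q ^ m * √(q ^ 2 - s ^ 2)`, `q = x (1 - x)`, over the interval `s ≤ q`. -/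
noncomputable def ovalIntegral (m : ℤ) (s : ℝ) : ℝ :=
  ∫ θ in (-(Real.pi / 2))..(Real.pi / 2), ovalIntegrand m s θ

/-- The derivative of `ovalIntegral m`, obtained by differentiating under the integral sign. -/
noncomputable def ovalIntegralDeriv (m : ℤ) (s : ℝ) : ℝ :=
  ∫ θ in (-(Real.pi / 2))..(Real.pi / 2), ovalIntegrandDeriv m s θ

lemma oval_base_pos {s : ℝ} (hs : s ∈ Ioo (0 : ℝ) (1 / 4)) (θ : ℝ) :
    0 < s + (1 / 4 - s) * Real.cos θ ^ 2 :=
  add_pos_of_pos_of_nonneg hs.1 (mul_nonneg (by linarith [hs.2]) (sq_nonneg _))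

lemma oval_radicand_pos {s : ℝ} (hs : s ∈ Ioo (0 : ℝ) (1 / 4)) (θ : ℝ) :
    0 < 2 * s + (1 / 4 - s) * Real.cos θ ^ 2 := by
  linarith [oval_base_pos hs θ, hs.1]

lemma hasDerivAt_ovalIntegrand (m : ℤ) {s : ℝ} (hs : s ∈ Ioo (0 : ℝ) (1 / 4)) (θ : ℝ) :
    HasDerivAt (fun s ↦ ovalIntegrand m s θ) (ovalIntegrandDeriv m s θ) s := by
  have he : HasDerivAt (fun s : ℝ ↦ (1 / 4 - s) * Real.cos θ ^ 2) (-1 * Real.cos θ ^ 2) s :=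
    ((hasDerivAt_id s).const_sub (1 / 4)).mul_const _
  have hq := (hasDerivAt_id s).add he
  have hz := (hasDerivAt_zpow m (s + (1 / 4 - s) * Real.cos θ ^ 2)
    (Or.inl (oval_base_pos hs θ).ne')).comp s hq
  have hw := (((hasDerivAt_id s).const_mul 2).add he).sqrt (oval_radicand_pos hs θ).ne'
  refine ((he.mul hz).mul hw).congr_deriv ?_
  simp only [ovalIntegrandDeriv, Function.comp, Pi.mul_apply, Pi.add_apply, id]
  ring

lemma continuousOn_ovalIntegrand (m : ℤ) :
    ContinuousOn (fun p : ℝ × ℝ ↦ ovalIntegrand m p.1 p.2) (Ioo (0 : ℝ) (1 / 4) ×ˢ univ) := by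
  unfold ovalIntegrand
  refine (ContinuousOn.mul (by fun_prop) (ContinuousOn.zpow₀ (by fun_prop) m
    fun p hp ↦ Or.inl (oval_base_pos hp.1 p.2).ne')).mul (by fun_prop)

lemma continuousOn_ovalIntegrandDeriv (m : ℤ) :
    ContinuousOn (fun p : ℝ × ℝ ↦ ovalIntegrandDeriv m p.1 p.2) (Ioo (0 : ℝ) (1 / 4) ×ˢ univ) := by
  have hz (k : ℤ) : ContinuousOn (fun p : ℝ × ℝ ↦ (p.1 + (1 / 4 - p.1) * Real.cos p.2 ^ 2) ^ k)
      (Ioo (0 : ℝ) (1 / 4) ×ˢ univ) :=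
    ContinuousOn.zpow₀ (by fun_prop) k fun p hp ↦ Or.inl (oval_base_pos hp.1 p.2).ne'
  have hd : ContinuousOn (fun p : ℝ × ℝ ↦ (2 - Real.cos p.2 ^ 2) /
      (2 * √(2 * p.1 + (1 / 4 - p.1) * Real.cos p.2 ^ 2))) (Ioo (0 : ℝ) (1 / 4) ×ˢ univ) :=
    ContinuousOn.div (by fun_prop) (by fun_prop) fun p hp ↦ by
      have := Real.sqrt_pos.2 (oval_radicand_pos hp.1 p.2)
      positivity
  have h1 := hz m
  have h2 := hz (m - 1)
  unfold ovalIntegrandDeriv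
  fun_prop

lemma continuous_ovalIntegrand (m : ℤ) {s : ℝ} (hs : s ∈ Ioo (0 : ℝ) (1 / 4)) :
    Continuous (ovalIntegrand m s) :=
  (continuousOn_ovalIntegrand m).comp_continuous (f := fun θ ↦ (s, θ)) (by fun_prop)
    fun _ ↦ ⟨hs, mem_univ _⟩

lemma continuous_ovalIntegrandDeriv (m : ℤ) {s : ℝ} (hs : s ∈ Ioo (0 : ℝ) (1 / 4)) :
    Continuous (ovalIntegrandDeriv m s) :=
  (continuousOn_ovalIntegrandDeriv m).comp_continuous (f := fun θ ↦ (s, θ)) (by fun_prop)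
    fun _ ↦ ⟨hs, mem_univ _⟩

lemma hasDerivAt_ovalIntegral (m : ℤ) {s : ℝ} (hs : s ∈ Ioo (0 : ℝ) (1 / 4)) :
    HasDerivAt (ovalIntegral m) (ovalIntegralDeriv m s) s := by
  obtain ⟨ε, hε, hball⟩ := Metric.nhds_basis_closedBall.mem_iff.1 (Ioo_mem_nhds hs.1 hs.2)
  obtain ⟨M, hM⟩ := ((isCompact_closedBall s ε).prod
    (isCompact_uIcc (a := -(Real.pi / 2)) (b := Real.pi / 2))).exists_bound_of_continuousOn
    ((continuousOn_ovalIntegrandDeriv m).mono (prod_mono hball (subset_univ _)))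
  refine (intervalIntegral.hasDerivAt_integral_of_dominated_loc_of_deriv_le
    (Metric.closedBall_mem_nhds s hε) (bound := fun _ ↦ M) ?_
    ((continuous_ovalIntegrand m hs).intervalIntegrable _ _)
    (continuous_ovalIntegrandDeriv m hs).aestronglyMeasurable ?_ (by simp) ?_).2
  · filter_upwards [Ioo_mem_nhds hs.1 hs.2] with r hr
    exact (continuous_ovalIntegrand m hr).aestronglyMeasurable
  · exact Eventually.of_forall fun θ hθ r hr ↦ hM (r, θ) ⟨hr, uIoc_subset_uIcc hθ⟩
  · exact Eventually.of_forall fun θ _ r hr ↦ hasDerivAt_ovalIntegrand m (hball hr) θ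

lemma hasDerivAt_oval_primitive {s : ℝ} (hs : s ∈ Ioo (0 : ℝ) (1 / 4)) {P : ℝ → ℝ} {P' θ : ℝ}
    (hP : HasDerivAt P P' (Real.cos θ ^ 2)) :
    HasDerivAt (fun θ ↦ Real.sin θ * Real.cos θ * P (Real.cos θ ^ 2) *
        √(2 * s + (1 / 4 - s) * Real.cos θ ^ 2))
      (((2 * Real.cos θ ^ 2 - 1) * P (Real.cos θ ^ 2) * (2 * s + (1 / 4 - s) * Real.cos θ ^ 2) -
        Real.cos θ ^ 2 * (1 - Real.cos θ ^ 2) *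
          (2 * P' * (2 * s + (1 / 4 - s) * Real.cos θ ^ 2) + P (Real.cos θ ^ 2) * (1 / 4 - s))) /
        √(2 * s + (1 / 4 - s) * Real.cos θ ^ 2)) θ := by
  have hC : HasDerivAt (fun θ ↦ Real.cos θ ^ 2) (2 * Real.cos θ * -Real.sin θ) θ := by
    simpa using (Real.hasDerivAt_cos θ).fun_pow 2
  have hw := ((hC.const_mul (1 / 4 - s)).const_add (2 * s)).sqrt (oval_radicand_pos hs θ).ne'
  refine ((((Real.hasDerivAt_sin θ).mul (Real.hasDerivAt_cos θ)).mul
    (hP.comp θ hC)).mul hw).congr_deriv ?_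
  have hpos := Real.sqrt_pos.2 (oval_radicand_pos hs θ)
  have hsq := Real.sq_sqrt (oval_radicand_pos hs θ).le
  have hsin := Real.sin_sq θ
  simp only [Function.comp, Pi.mul_apply]
  generalize √(2 * s + (1 / 4 - s) * Real.cos θ ^ 2) = w at *
  rw [← hsq]
  field_simp
  linear_combination (-4 * P (Real.cos θ ^ 2) * w ^ 2 - 8 * w ^ 2 * Real.cos θ ^ 2 * P' -
    4 * Real.cos θ ^ 2 * P (Real.cos θ ^ 2) * (1 / 4 - s)) * hsin

lemma integral_eq_zero_of_oval_primitive {s : ℝ} (hs : s ∈ Ioo (0 : ℝ) (1 / 4)) {P P' f : ℝ → ℝ}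
    (hf : Continuous f) (hP : ∀ C, 0 ≤ C → HasDerivAt P (P' C) C)
    (h : ∀ θ, f θ * √(2 * s + (1 / 4 - s) * Real.cos θ ^ 2) =
      (2 * Real.cos θ ^ 2 - 1) * P (Real.cos θ ^ 2) * (2 * s + (1 / 4 - s) * Real.cos θ ^ 2) -
        Real.cos θ ^ 2 * (1 - Real.cos θ ^ 2) *
          (2 * P' (Real.cos θ ^ 2) * (2 * s + (1 / 4 - s) * Real.cos θ ^ 2) +
            P (Real.cos θ ^ 2) * (1 / 4 - s))) :
    ∫ θ in (-(Real.pi / 2))..(Real.pi / 2), f θ = 0 := by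
  rw [intervalIntegral.integral_eq_sub_of_hasDerivAt (fun θ _ ↦
    (hasDerivAt_oval_primitive hs (hP _ (sq_nonneg (Real.cos θ)))).congr_deriv
      (g' := f θ) ?_) (hf.intervalIntegrable _ _)]
  · simp
  · rw [← h θ, mul_div_cancel_right₀ _ (Real.sqrt_pos.2 (oval_radicand_pos hs θ)).ne']

lemma ovalIntegral_zero_ode {s : ℝ} (hs : s ∈ Ioo (0 : ℝ) (1 / 4)) :
    (8 * s ^ 3 - s / 2) / 2 * ovalIntegralDeriv 0 s =
      (6 * s ^ 2 - 1 / 2) * ovalIntegral 0 s + 5 / 2 * ovalIntegral 1 s := by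
  have hF (m : ℤ) := continuous_ovalIntegrand m hs
  have hF' (m : ℤ) := continuous_ovalIntegrandDeriv m hs
  have key := integral_eq_zero_of_oval_primitive hs
    (f := fun θ ↦ (8 * s ^ 3 - s / 2) / 2 * ovalIntegrandDeriv 0 s θ -
      (6 * s ^ 2 - 1 / 2) * ovalIntegrand 0 s θ - 5 / 2 * ovalIntegrand 1 s θ)
    (P := fun C ↦ -(1 / 2) * (1 / 4 - s) ^ 2 * C) (P' := fun _ ↦ -(1 / 2) * (1 / 4 - s) ^ 2)
    (by fun_prop) (fun C _ ↦ by
      simpa only [mul_one, id] using (hasDerivAt_id C).const_mul (-(1 / 2) * (1 / 4 - s) ^ 2))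
    fun θ ↦ by
      have hpos := Real.sqrt_pos.2 (oval_radicand_pos hs θ)
      have hsq := Real.sq_sqrt (oval_radicand_pos hs θ).le
      simp only [ovalIntegrand, ovalIntegrandDeriv, zpow_zero, zpow_one, Int.cast_zero]
      generalize √(2 * s + (1 / 4 - s) * Real.cos θ ^ 2) = w at *
      field_simp
      rw [hsq]
      ring
  rw [intervalIntegral.integral_sub, intervalIntegral.integral_sub] at key
  · simp only [intervalIntegral.integral_const_mul] at key
    unfold ovalIntegral ovalIntegralDeriv
    linear_combination key
  all_goals exact Continuous.intervalIntegrable (by fun_prop) _ _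

lemma ovalIntegral_one_ode {s : ℝ} (hs : s ∈ Ioo (0 : ℝ) (1 / 4)) :
    (8 * s ^ 3 - s / 2) * (ovalIntegralDeriv 0 s / 2 - ovalIntegralDeriv 1 s) =
      (3 / 2 - 6 * s ^ 2) * (ovalIntegral 0 s / 2) +
        (-(5 / 2) + 20 * s ^ 2) * (ovalIntegral 0 s / 2 - ovalIntegral 1 s) := by
  have hF (m : ℤ) := continuous_ovalIntegrand m hs
  have hF' (m : ℤ) := continuous_ovalIntegrandDeriv m hs
  have key := integral_eq_zero_of_oval_primitive hs
    (f := fun θ ↦ (8 * s ^ 3 - s / 2) / 2 * ovalIntegrandDeriv 0 s θ -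
      (8 * s ^ 3 - s / 2) * ovalIntegrandDeriv 1 s θ -
      (7 * s ^ 2 - 1 / 2) * ovalIntegrand 0 s θ + (20 * s ^ 2 - 5 / 2) * ovalIntegrand 1 s θ)
    (P := fun C ↦ (-(1 / 32) + 3 / 16 * s - s ^ 3) * C)
    (P' := fun _ ↦ -(1 / 32) + 3 / 16 * s - s ^ 3)
    (by fun_prop)
    (fun C _ ↦ by simpa using (hasDerivAt_id C).const_mul (-(1 / 32) + 3 / 16 * s - s ^ 3))
    fun θ ↦ by
      have hpos := Real.sqrt_pos.2 (oval_radicand_pos hs θ)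
      have hsq := Real.sq_sqrt (oval_radicand_pos hs θ).le
      simp only [ovalIntegrand, ovalIntegrandDeriv, zpow_zero, zpow_one, Int.cast_zero,
        Int.cast_one, sub_self]
      generalize √(2 * s + (1 / 4 - s) * Real.cos θ ^ 2) = w at *
      field_simp
      rw [hsq]
      ring
  rw [intervalIntegral.integral_add, intervalIntegral.integral_sub,
    intervalIntegral.integral_sub] at key
  · simp only [intervalIntegral.integral_const_mul] at key
    unfold ovalIntegral ovalIntegralDeriv
    linear_combination key
  all_goals exact Continuous.intervalIntegrable (by fun_prop) _ _

lemma ovalIntegral_neg_one_ode {s : ℝ} (hs : s ∈ Ioo (0 : ℝ) (1 / 4)) :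
    (8 * s ^ 3 - s / 2) * (ovalIntegralDeriv (-1) s / 2) =
      (-(1 / 2) + 8 * s ^ 2) * (ovalIntegral (-1) s / 2) + 9 * (ovalIntegral 0 s / 2) -
        10 * (ovalIntegral 0 s / 2 - ovalIntegral 1 s) := by
  have hF (m : ℤ) := continuous_ovalIntegrand m hs
  have hF' (m : ℤ) := continuous_ovalIntegrandDeriv m hs
  have key := integral_eq_zero_of_oval_primitive hs
    (f := fun θ ↦ (8 * s ^ 3 - s / 2) / 2 * ovalIntegrandDeriv (-1) s θ -
      (4 * s ^ 2 - 1 / 4) * ovalIntegrand (-1) s θ +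
      1 / 2 * ovalIntegrand 0 s θ - 10 * ovalIntegrand 1 s θ)
    (P := fun C ↦ (2 * s ^ 2 - 1 / 8) - 2 * (1 / 4 - s) ^ 2 * C +
      (s / 8 - 2 * s ^ 3) * (s + (1 / 4 - s) * C)⁻¹)
    (P' := fun C ↦ -(2 * (1 / 4 - s) ^ 2) +
      (s / 8 - 2 * s ^ 3) * (-(1 / 4 - s) / (s + (1 / 4 - s) * C) ^ 2))
    (by fun_prop)
    (fun C hC ↦ by
      have hq : s + (1 / 4 - s) * C ≠ 0 :=
        (add_pos_of_pos_of_nonneg hs.1 (mul_nonneg (by linarith [hs.2]) hC)).ne'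
      have h1 : HasDerivAt (fun C : ℝ ↦ s + (1 / 4 - s) * C) (1 / 4 - s) C := by
        simpa using ((hasDerivAt_id C).const_mul (1 / 4 - s)).const_add s
      have h2 : HasDerivAt (fun C : ℝ ↦ (2 * s ^ 2 - 1 / 8) - 2 * (1 / 4 - s) ^ 2 * C)
          (-(2 * (1 / 4 - s) ^ 2)) C := by
        simpa using ((hasDerivAt_id C).const_mul (2 * (1 / 4 - s) ^ 2)).const_sub (2 * s ^ 2 - 1 / 8)
      exact h2.add ((h1.inv hq).const_mul _))
    fun θ ↦ by
      have hpos := Real.sqrt_pos.2 (oval_radicand_pos hs θ)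
      have hsq := Real.sq_sqrt (oval_radicand_pos hs θ).le
      have hq := oval_base_pos hs θ
      have hz : (s + (1 / 4 - s) * Real.cos θ ^ 2) ^ (-1 - 1 : ℤ) =
          ((s + (1 / 4 - s) * Real.cos θ ^ 2) ^ 2)⁻¹ := by
        rw [show (-1 - 1 : ℤ) = -(2 : ℕ) by norm_num, zpow_neg, zpow_natCast]
      simp only [ovalIntegrand, ovalIntegrandDeriv, zpow_zero, zpow_one, zpow_neg_one, hz,
        Int.cast_neg, Int.cast_one]
      generalize √(2 * s + (1 / 4 - s) * Real.cos θ ^ 2) = w at *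
      generalize hC : Real.cos θ ^ 2 = C at *
      obtain ⟨q, hqd⟩ : ∃ q, q = s + (1 / 4 - s) * C := ⟨_, rfl⟩
      rw [← hqd] at hq ⊢
      have hw2 : w ^ 2 = q + s := by rw [hsq, hqd]; ring
      field_simp
      rw [hw2, hqd]
      ring
  rw [intervalIntegral.integral_sub, intervalIntegral.integral_add,
    intervalIntegral.integral_sub] at key
  · simp only [intervalIntegral.integral_const_mul] at key
    unfold ovalIntegral ovalIntegralDeriv
    linear_combination key
  all_goals exact Continuous.intervalIntegrable (by fun_prop) _ _

lemma mem_Δset_iff_s15 {s x y : ℝ} (hs : 0 < s) :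
    (x, y) ∈ Δset (s ^ 2 / 4) ↔ (0 < x ∧ s ≤ x * (1 - x)) ∧
      y ∈ Icc ((1 - x) / 2 - √((x * (1 - x)) ^ 2 - s ^ 2) / x / 2)
        ((1 - x) / 2 + √((x * (1 - x)) ^ 2 - s ^ 2) / x / 2) := by
  simp only [Δset, mem_ofPred_eq, mem_Icc]
  constructor
  · rintro ⟨hx, hy, h⟩
    have hxy : 0 < 1 - x - y := by
      by_contra! hle
      nlinarith [mul_nonneg (mul_pos (pow_pos hx 2) hy).le (neg_nonneg.2 hle), pow_pos hs 2]
    have hsq : (x * (2 * y - (1 - x))) ^ 2 ≤ (x * (1 - x)) ^ 2 - s ^ 2 := by linarith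
    have habs := abs_le.1 (Real.abs_le_sqrt hsq)
    have hle : s ≤ x * (1 - x) :=
      le_of_sq_le_sq (by nlinarith [sq_nonneg (x * (2 * y - (1 - x)))])
        (mul_nonneg hx.le (by linarith))
    have e : √((x * (1 - x)) ^ 2 - s ^ 2) = √((x * (1 - x)) ^ 2 - s ^ 2) / x * x := by
      field_simp
    generalize √((x * (1 - x)) ^ 2 - s ^ 2) / x = r at *
    rw [e] at habs
    refine ⟨⟨hx, hle⟩, ?_, ?_⟩
    · have : -r ≤ 2 * y - (1 - x) := le_of_mul_le_mul_left (by linarith [habs.1]) hx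
      linarith
    · have : 2 * y - (1 - x) ≤ r := le_of_mul_le_mul_left (by linarith [habs.2]) hx
      linarith
  · rintro ⟨⟨hx, hle⟩, h1, h2⟩
    have h0 : 0 ≤ (x * (1 - x)) ^ 2 - s ^ 2 := by nlinarith
    have hr := Real.sq_sqrt h0
    have e : √((x * (1 - x)) ^ 2 - s ^ 2) = √((x * (1 - x)) ^ 2 - s ^ 2) / x * x := by
      field_simp
    generalize √((x * (1 - x)) ^ 2 - s ^ 2) / x = r at *
    rw [e] at hr
    have hsq : (2 * y - (1 - x)) ^ 2 ≤ r ^ 2 := sq_le_sq' (by linarith) (by linarith)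
    have hH : s ^ 2 / 4 ≤ x ^ 2 * y * (1 - x - y) := by
      nlinarith [mul_le_mul_of_nonneg_left hsq (sq_nonneg x)]
    refine ⟨hx, ?_, hH⟩
    have hprod : 0 < y * (1 - x - y) := by
      by_contra! hle'
      nlinarith [mul_nonneg (sq_nonneg x) (neg_nonneg.2 hle'), pow_pos hs 2]
    have hx1 : 0 < 1 - x := by
      by_contra! hle'
      nlinarith [mul_nonneg hx.le (neg_nonneg.2 hle')]
    by_contra! hy
    nlinarith [mul_nonneg (neg_nonneg.2 hy) (by linarith : 0 ≤ 1 - x - y)]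

lemma Δset_eq_inter {t : ℝ} (ht : 0 < t) :
    Δset t = (Icc t 1 ×ˢ Icc 0 1) ∩ {z | t ≤ z.1 ^ 2 * z.2 * (1 - z.1 - z.2)} := by
  ext ⟨x, y⟩
  simp only [Δset, mem_ofPred_eq, mem_inter_iff, mem_prod, mem_Icc]
  constructor
  · rintro ⟨hx, hy, h⟩
    have hxy : 0 < 1 - x - y := by
      by_contra! hle
      nlinarith [mul_nonneg (mul_pos (pow_pos hx 2) hy).le (neg_nonneg.2 hle)]
    have h1 : y * (1 - x - y) ≤ 1 := mul_le_one₀ (by linarith) hxy.le (by linarith)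
    have h2 : x ^ 2 * (y * (1 - x - y)) ≤ x ^ 2 := mul_le_of_le_one_right (sq_nonneg x) h1
    exact ⟨⟨⟨by nlinarith, by linarith⟩, hy.le, by linarith⟩, h⟩
  · rintro ⟨⟨⟨hx, -⟩, hy, -⟩, h⟩
    refine ⟨by linarith, hy.lt_of_ne ?_, h⟩
    rintro rfl
    simp at h
    linarith

lemma isCompact_Δset {t : ℝ} (ht : 0 < t) : IsCompact (Δset t) := by
  rw [Δset_eq_inter ht]
  exact (isCompact_Icc.prod isCompact_Icc).inter_right
    (isClosed_le continuous_const (by fun_prop))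

lemma setOf_le_mul_one_sub_eq_Icc {s : ℝ} (hs : s ∈ Ioo (0 : ℝ) (1 / 4)) :
    {x : ℝ | 0 < x ∧ s ≤ x * (1 - x)} = Icc (1 / 2 - √(1 / 4 - s)) (1 / 2 + √(1 / 4 - s)) := by
  have hsq := Real.sq_sqrt (show 0 ≤ 1 / 4 - s by linarith [hs.2])
  have hc := Real.sqrt_nonneg (1 / 4 - s)
  ext x
  simp only [mem_ofPred_eq, mem_Icc]
  constructor
  · rintro ⟨-, h⟩
    have := abs_le.1 (Real.abs_le_sqrt (show (x - 1 / 2) ^ 2 ≤ 1 / 4 - s by linarith))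
    exact ⟨by linarith [this.1], by linarith [this.2]⟩
  · rintro ⟨h1, h2⟩
    have h : (x - 1 / 2) ^ 2 ≤ √(1 / 4 - s) ^ 2 := sq_le_sq' (by linarith) (by linarith)
    have hlt : √(1 / 4 - s) < 1 / 2 := (Real.sqrt_lt' (by norm_num)).2 (by linarith [hs.1])
    exact ⟨by linarith, by linarith⟩

lemma Iab_eq_intervalIntegral (i : ℤ) {s : ℝ} (hs : s ∈ Ioo (0 : ℝ) (1 / 4)) :
    Iab i 0 (s ^ 2 / 4) = ∫ x in (1 / 2 - √(1 / 4 - s))..(1 / 2 + √(1 / 4 - s)),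
      x ^ (i - 1) * √((x * (1 - x)) ^ 2 - s ^ 2) := by
  have hs0 := hs.1
  have ht : 0 < s ^ 2 / 4 := by positivity
  have hmeas := (isCompact_Δset ht).measurableSet
  have hint : IntegrableOn (fun z : ℝ × ℝ ↦ z.1 ^ i * z.2 ^ (0 : ℤ)) (Δset (s ^ 2 / 4)) := by
    simp only [zpow_zero, mul_one]
    exact (continuous_fst.continuousOn.zpow₀ i fun z hz ↦ Or.inl hz.1.ne').integrableOn_compact
      (isCompact_Δset ht)
  have hinner (x : ℝ) : ∫ y, (Δset (s ^ 2 / 4)).indicator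
      (fun z : ℝ × ℝ ↦ z.1 ^ i * z.2 ^ (0 : ℤ)) (x, y) =
      {x : ℝ | 0 < x ∧ s ≤ x * (1 - x)}.indicator
        (fun x ↦ x ^ (i - 1) * √((x * (1 - x)) ^ 2 - s ^ 2)) x := by
    by_cases hx : 0 < x ∧ s ≤ x * (1 - x)
    · have hfun : (fun y ↦ (Δset (s ^ 2 / 4)).indicator
          (fun z : ℝ × ℝ ↦ z.1 ^ i * z.2 ^ (0 : ℤ)) (x, y)) =
          (Icc ((1 - x) / 2 - √((x * (1 - x)) ^ 2 - s ^ 2) / x / 2)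
            ((1 - x) / 2 + √((x * (1 - x)) ^ 2 - s ^ 2) / x / 2)).indicator fun _ ↦ x ^ i := by
        ext y
        classical
        simp only [indicator_apply, mem_Δset_iff_s15 hs0, hx, zpow_zero, mul_one, true_and, and_self]
      have hr : 0 ≤ √((x * (1 - x)) ^ 2 - s ^ 2) / x := div_nonneg (Real.sqrt_nonneg _) hx.1.le
      rw [hfun, integral_indicator measurableSet_Icc, setIntegral_const,
        indicator_of_mem (by exact hx), Real.volume_real_Icc_of_le (by linarith),
        zpow_sub_one₀ hx.1.ne', smul_eq_mul]
      ring
    · rw [indicator_of_notMem (by exact hx)]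
      refine integral_eq_zero_of_ae (Eventually.of_forall fun y ↦ indicator_of_notMem ?_ _)
      rw [mem_Δset_iff_s15 hs0]
      exact fun h ↦ hx h.1
  rw [Iab, ← integral_indicator hmeas, Measure.volume_eq_prod,
    integral_prod _ ((integrable_indicator_iff hmeas).2 hint)]
  simp_rw [hinner]
  rw [setOf_le_mul_one_sub_eq_Icc hs, integral_indicator measurableSet_Icc,
    integral_Icc_eq_integral_Ioc, intervalIntegral.integral_of_le]
  linarith [Real.sqrt_nonneg (1 / 4 - s)]

lemma Iab_eq_integral_trig (i : ℤ) {s : ℝ} (hs : s ∈ Ioo (0 : ℝ) (1 / 4)) :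
    Iab i 0 (s ^ 2 / 4) = ∫ θ in (-(Real.pi / 2))..(Real.pi / 2),
      (1 / 2 + √(1 / 4 - s) * Real.sin θ) ^ (i - 1) * ovalIntegrand 0 s θ := by
  have hsq := Real.sq_sqrt (show 0 ≤ 1 / 4 - s by linarith [hs.2])
  have hc := Real.sqrt_nonneg (1 / 4 - s)
  have hpos (θ : ℝ) : 0 < 1 / 2 + √(1 / 4 - s) * Real.sin θ := by
    have hlt : √(1 / 4 - s) < 1 / 2 := (Real.sqrt_lt' (by norm_num)).2 (by linarith [hs.1])
    nlinarith [Real.neg_one_le_sin θ]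
  have hpi := Real.pi_pos
  rw [Iab_eq_intervalIntegral i hs]
  have hsub := intervalIntegral.integral_comp_mul_deriv' (a := -(Real.pi / 2)) (b := Real.pi / 2)
    (f := fun θ ↦ 1 / 2 + √(1 / 4 - s) * Real.sin θ) (f' := fun θ ↦ √(1 / 4 - s) * Real.cos θ)
    (g := fun x ↦ x ^ (i - 1) * √((x * (1 - x)) ^ 2 - s ^ 2))
    (fun θ _ ↦ ((Real.hasDerivAt_sin θ).const_mul _).const_add _) (by fun_prop)
    (ContinuousOn.mul (continuousOn_id.zpow₀ _ (by
      rintro _ ⟨θ, -, rfl⟩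
      exact Or.inl (hpos θ).ne')) (by fun_prop))
  simp only [Real.sin_neg, Real.sin_pi_div_two, mul_neg, mul_one, ← sub_eq_add_neg] at hsub
  rw [← hsub]
  refine intervalIntegral.integral_congr fun θ hθ ↦ ?_
  rw [uIcc_of_le (by linarith)] at hθ
  have hcos := Real.cos_nonneg_of_mem_Icc hθ
  have hq : (1 / 2 + √(1 / 4 - s) * Real.sin θ) * (1 - (1 / 2 + √(1 / 4 - s) * Real.sin θ)) =
      s + (1 / 4 - s) * Real.cos θ ^ 2 := by
    linear_combination (-Real.sin θ ^ 2) * hsq - (1 / 4 - s) * Real.sin_sq_add_cos_sq θ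
  have hw : √((s + (1 / 4 - s) * Real.cos θ ^ 2) ^ 2 - s ^ 2) =
      √(1 / 4 - s) * Real.cos θ * √(2 * s + (1 / 4 - s) * Real.cos θ ^ 2) := by
    rw [show (s + (1 / 4 - s) * Real.cos θ ^ 2) ^ 2 - s ^ 2 = (√(1 / 4 - s) * Real.cos θ) ^ 2 *
        (2 * s + (1 / 4 - s) * Real.cos θ ^ 2) by rw [mul_pow, hsq]; ring,
      Real.sqrt_mul (sq_nonneg _), Real.sqrt_sq (mul_nonneg hc hcos)]
  simp only [Function.comp, hq, hw, ovalIntegrand, zpow_zero]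
  linear_combination ((1 / 2 + √(1 / 4 - s) * Real.sin θ) ^ (i - 1) * Real.cos θ ^ 2 *
    √(2 * s + (1 / 4 - s) * Real.cos θ ^ 2)) * hsq

lemma Iab_eq_integral_symm (i : ℤ) {s : ℝ} (hs : s ∈ Ioo (0 : ℝ) (1 / 4)) :
    Iab i 0 (s ^ 2 / 4) = 1 / 2 * ∫ θ in (-(Real.pi / 2))..(Real.pi / 2),
      ((1 / 2 + √(1 / 4 - s) * Real.sin θ) ^ (i - 1) +
        (1 / 2 - √(1 / 4 - s) * Real.sin θ) ^ (i - 1)) * ovalIntegrand 0 s θ := by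
  have hlt : √(1 / 4 - s) < 1 / 2 := (Real.sqrt_lt' (by norm_num)).2 (by linarith [hs.1])
  have hc := Real.sqrt_nonneg (1 / 4 - s)
  have hF := continuous_ovalIntegrand 0 hs
  have hp : Continuous fun θ ↦ (1 / 2 + √(1 / 4 - s) * Real.sin θ) ^ (i - 1) :=
    Continuous.zpow₀ (by fun_prop) _ fun θ ↦ Or.inl (by nlinarith [Real.neg_one_le_sin θ] :
      0 < 1 / 2 + √(1 / 4 - s) * Real.sin θ).ne'
  have hm : Continuous fun θ ↦ (1 / 2 - √(1 / 4 - s) * Real.sin θ) ^ (i - 1) :=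
    Continuous.zpow₀ (by fun_prop) _ fun θ ↦ Or.inl (by nlinarith [Real.sin_le_one θ] :
      0 < 1 / 2 - √(1 / 4 - s) * Real.sin θ).ne'
  have hneg : Iab i 0 (s ^ 2 / 4) = ∫ θ in (-(Real.pi / 2))..(Real.pi / 2),
      (1 / 2 - √(1 / 4 - s) * Real.sin θ) ^ (i - 1) * ovalIntegrand 0 s θ := by
    rw [Iab_eq_integral_trig i hs, ← neg_neg (Real.pi / 2), ← intervalIntegral.integral_comp_neg]
    simp [ovalIntegrand, sub_eq_add_neg]
  simp only [add_mul]
  rw [intervalIntegral.integral_add ((hp.fun_mul hF).intervalIntegrable _ _)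
    ((hm.fun_mul hF).intervalIntegrable _ _), ← hneg, ← Iab_eq_integral_trig i hs]
  ring

lemma J1_eq {s : ℝ} (hs : s ∈ Ioo (0 : ℝ) (1 / 4)) :
    J1 (s ^ 2 / 4) = ovalIntegral (-1) s / 2 := by
  have hsq := Real.sq_sqrt (show 0 ≤ 1 / 4 - s by linarith [hs.2])
  have hlt : √(1 / 4 - s) < 1 / 2 := (Real.sqrt_lt' (by norm_num)).2 (by linarith [hs.1])
  have hc := Real.sqrt_nonneg (1 / 4 - s)
  rw [J1, Iab_eq_integral_symm 0 hs, ovalIntegral, one_div_mul_eq_div]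
  congr 1
  refine intervalIntegral.integral_congr fun θ _ ↦ ?_
  have hp : 0 < 1 / 2 + √(1 / 4 - s) * Real.sin θ := by nlinarith [Real.neg_one_le_sin θ]
  have hm : 0 < 1 / 2 - √(1 / 4 - s) * Real.sin θ := by nlinarith [Real.sin_le_one θ]
  have hq : s + (1 / 4 - s) * Real.cos θ ^ 2 =
      (1 / 2 + √(1 / 4 - s) * Real.sin θ) * (1 / 2 - √(1 / 4 - s) * Real.sin θ) := by
    linear_combination (Real.sin θ ^ 2) * hsq + (1 / 4 - s) * Real.sin_sq_add_cos_sq θ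
  have hinv : (1 / 2 + √(1 / 4 - s) * Real.sin θ)⁻¹ + (1 / 2 - √(1 / 4 - s) * Real.sin θ)⁻¹ =
      (s + (1 / 4 - s) * Real.cos θ ^ 2)⁻¹ := by
    rw [hq, inv_add_inv hp.ne' hm.ne', inv_eq_one_div]
    congr 1
    ring
  simp only [ovalIntegrand, zero_sub, zpow_neg_one, zpow_zero, hinv]
  ring

lemma J2_eq {s : ℝ} (hs : s ∈ Ioo (0 : ℝ) (1 / 4)) :
    J2 (s ^ 2 / 4) = ovalIntegral 0 s / 2 := by
  rw [J2, Iab_eq_integral_symm 2 hs, ovalIntegral, one_div_mul_eq_div]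
  congr 1
  refine intervalIntegral.integral_congr fun θ _ ↦ ?_
  simp only [show (2 - 1 : ℤ) = 1 by norm_num, zpow_one]
  ring

lemma J3_eq {s : ℝ} (hs : s ∈ Ioo (0 : ℝ) (1 / 4)) :
    J3 (s ^ 2 / 4) = ovalIntegral 0 s / 2 - ovalIntegral 1 s := by
  have hsq := Real.sq_sqrt (show 0 ≤ 1 / 4 - s by linarith [hs.2])
  have hF (m : ℤ) := continuous_ovalIntegrand m hs
  have hcomb : ∫ θ in (-(Real.pi / 2))..(Real.pi / 2),
      (ovalIntegrand 0 s θ - 2 * ovalIntegrand 1 s θ) =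
      ovalIntegral 0 s - 2 * ovalIntegral 1 s := by
    rw [intervalIntegral.integral_sub ((hF 0).intervalIntegrable _ _)
      (((hF 1).const_mul 2).intervalIntegrable _ _), intervalIntegral.integral_const_mul]
    rfl
  rw [J3, Iab_eq_integral_symm 3 hs,
    show ovalIntegral 0 s / 2 - ovalIntegral 1 s =
      1 / 2 * (ovalIntegral 0 s - 2 * ovalIntegral 1 s) by ring, ← hcomb]
  congr 1
  refine intervalIntegral.integral_congr fun θ _ ↦ ?_
  simp only [show (3 - 1 : ℤ) = (2 : ℕ) by norm_num, zpow_natCast, ovalIntegrand, zpow_zero,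
    zpow_one]
  linear_combination (2 * (1 / 4 - s) * Real.cos θ ^ 2 *
    √(2 * s + (1 / 4 - s) * Real.cos θ ^ 2)) * (Real.sin θ ^ 2 * hsq +
      (1 / 4 - s) * Real.sin_sq_add_cos_sq θ)

lemma hasDerivAt_of_comp_sq_div_four {J Φ : ℝ → ℝ} {Φ' s : ℝ} (hs : s ∈ Ioo (0 : ℝ) (1 / 4))
    (hJ : ∀ r ∈ Ioo (0 : ℝ) (1 / 4), J (r ^ 2 / 4) = Φ r) (hΦ : HasDerivAt Φ Φ' s) :
    HasDerivAt J (Φ' * (2 / s)) (s ^ 2 / 4) := by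
  have hs0 := hs.1
  have hroot : 2 * √(s ^ 2 / 4) = s := by
    rw [Real.sqrt_div (sq_nonneg s), Real.sqrt_sq hs0.le, show (4 : ℝ) = 2 ^ 2 by norm_num,
      Real.sqrt_sq (by norm_num)]
    ring
  have hd : HasDerivAt (fun t ↦ 2 * √t) (2 / s) (s ^ 2 / 4) := by
    refine ((Real.hasDerivAt_sqrt (by positivity : s ^ 2 / 4 ≠ 0)).const_mul 2).congr_deriv ?_
    rw [hroot]
    ring
  rw [← hroot] at hΦ
  refine (hΦ.comp (s ^ 2 / 4) hd).congr_of_eventuallyEq ?_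
  have hmem : ∀ᶠ t in nhds (s ^ 2 / 4), 2 * √t ∈ Ioo (0 : ℝ) (1 / 4) :=
    hd.continuousAt.eventually_mem (by rw [hroot]; exact Ioo_mem_nhds hs.1 hs.2)
  filter_upwards [hmem, Ioi_mem_nhds (by positivity : 0 < s ^ 2 / 4)] with t ht ht0
  rw [Function.comp, ← hJ _ ht, mul_pow, Real.sq_sqrt (le_of_lt ht0)]
  congr 1
  ring

/-- the Picard–Fuchs system in the resolved form (10):
`D(t) J' = Q(t) J` with `D(t) = 64t² - t`. -/
theorem picard_fuchs_resolved (t : ℝ) (ht : t ∈ Set.Ioo (0 : ℝ) (1 / 64)) :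
    DifferentiableAt ℝ J1 t ∧ DifferentiableAt ℝ J2 t ∧ DifferentiableAt ℝ J3 t ∧
    (64 * t ^ 2 - t) * deriv J1 t = (-(1 / 2) + 32 * t) * J1 t + 9 * J2 t - 10 * J3 t ∧
    (64 * t ^ 2 - t) * deriv J2 t = (3 / 2 + 48 * t) * J2 t - (5 / 2) * J3 t ∧
    (64 * t ^ 2 - t) * deriv J3 t = (3 / 2 - 24 * t) * J2 t + (-(5 / 2) + 80 * t) * J3 t := by
  obtain ⟨ht0, ht1⟩ := ht
  obtain ⟨s, hs, rfl⟩ : ∃ s ∈ Ioo (0 : ℝ) (1 / 4), s ^ 2 / 4 = t := by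
    refine ⟨2 * √t, ⟨by positivity, ?_⟩, by rw [mul_pow, Real.sq_sqrt ht0.le]; ring⟩
    have : √t < 1 / 8 := (Real.sqrt_lt' (by norm_num)).2 (by linarith)
    linarith
  have hs0 : s ≠ 0 := hs.1.ne'
  have h1 := hasDerivAt_of_comp_sq_div_four hs (fun _ ↦ J1_eq)
    ((hasDerivAt_ovalIntegral (-1) hs).div_const 2)
  have h2 := hasDerivAt_of_comp_sq_div_four hs (fun _ ↦ J2_eq)
    ((hasDerivAt_ovalIntegral 0 hs).div_const 2)
  have h3 := hasDerivAt_of_comp_sq_div_four hs (fun _ ↦ J3_eq)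
    (((hasDerivAt_ovalIntegral 0 hs).div_const 2).sub (hasDerivAt_ovalIntegral 1 hs))
  have hD (d : ℝ) : (64 * (s ^ 2 / 4) ^ 2 - s ^ 2 / 4) * (d * (2 / s)) =
      (8 * s ^ 3 - s / 2) * d := by
    field_simp
    ring
  refine ⟨h1.differentiableAt, h2.differentiableAt, h3.differentiableAt, ?_, ?_, ?_⟩
  · rw [h1.deriv, J1_eq hs, J2_eq hs, J3_eq hs, hD]
    linear_combination ovalIntegral_neg_one_ode hs
  · rw [h2.deriv, J2_eq hs, J3_eq hs, hD]
    linear_combination ovalIntegral_zero_ode hs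
  · rw [h3.deriv, J2_eq hs, J3_eq hs, hD]
    linear_combination ovalIntegral_one_ode hs
end
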